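/- arXiv:1108.0010 — 2 statements merged into one kernel-verified Lean document; each statement's English description precedes it below -/
import Mathlib

section
/- Let N = S × ⋯ × S, a direct product of k copies of a nonabelian simple group S, be a minimal normal subgroup of a finite group K. If χ ∈ Irr(S) extends to a character of Aut(S), then χ(1)^k is a character degree of K, i.e. χ(1)^k ∈ cd(K). -/
open CategoryTheory

/-- The set of degrees of irreducible complex characters of `G`. -/
noncomputable def charDegrees (G : Type) [Group G] : Set ℕ :=
  {n | ∃ V : FDRep ℂ G, Simple V ∧ Module.finrank ℂ V = n}

section AutPi

variable {S ι : Type*} [Group S]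

/-- An automorphism of a finite power of a nonabelian simple group permutes the coordinates
up to automorphisms of the factor. -/
theorem exists_coord_mulAut_pi [Finite ι] [Finite S] [IsSimpleGroup S]
    (hnab : ¬ ∀ a b : S, a * b = b * a) (α : MulAut (ι → S)) (i : ι) :
    ∃ p : ι × MulAut S, ∀ x, α x i = p.2 (x p.1) := by
  classical
  let f : (ι → S) →* S := (Pi.evalMonoidHom (fun _ => S) i).comp α.toMonoidHom
  have hf : Function.Surjective f := fun s =>
    ⟨α.symm (Function.const ι s), by simp [f]⟩
  let g : ι → S →* S := fun j => f.comp (MonoidHom.mulSingle (fun _ => S) j)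
  have hnorm : ∀ j, (g j).range.Normal := by
    intro j
    refine ⟨?_⟩
    rintro _ ⟨s, rfl⟩ t
    obtain ⟨x, rfl⟩ := hf t
    refine ⟨x j * s * (x j)⁻¹, ?_⟩
    simp only [g, MonoidHom.comp_apply, MonoidHom.mulSingle_apply, ← map_inv, ← map_mul]
    congr 1
    ext l
    by_cases h : l = j
    · subst h; simp
    · simp [h]
  have hbt : ∀ j, (g j).range = ⊥ ∨ (g j).range = ⊤ := fun j =>
    (hnorm j).eq_bot_or_eq_top
  have hcomm : ∀ j l, j ≠ l → ∀ s t, g j s * g l t = g l t * g j s := by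
    intro j l h s t
    simp only [g, MonoidHom.comp_apply, MonoidHom.mulSingle_apply, ← map_mul]
    exact congrArg f (Pi.mulSingle_commute (f := fun _ => S) h s t)
  obtain ⟨j, hj⟩ : ∃ j, (g j).range = ⊤ := by
    by_contra! hcon
    have hbot : ∀ j s, g j s = 1 := fun j s => by
      have h := (hbt j).resolve_right (hcon j)
      have : g j s ∈ (g j).range := ⟨s, rfl⟩
      rwa [h, Subgroup.mem_bot] at this
    have h1 : f = 1 := MonoidHom.pi_ext fun j s => hbot j s
    obtain ⟨s, hs⟩ := exists_ne (1 : S)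
    obtain ⟨x, hx⟩ := hf s
    exact hs (by rw [← hx, h1]; rfl)
  have hsurj : Function.Surjective (g j) := MonoidHom.range_eq_top.mp hj
  have htriv : ∀ l, l ≠ j → ∀ s, g l s = 1 := by
    intro l hl s
    rcases hbt l with h | h
    · have : g l s ∈ (g l).range := ⟨s, rfl⟩
      rwa [h, Subgroup.mem_bot] at this
    · refine absurd (fun a b => ?_) hnab
      obtain ⟨a, rfl⟩ := hsurj a
      obtain ⟨b, rfl⟩ := MonoidHom.range_eq_top.mp h b
      exact hcomm _ _ hl.symm _ _
  refine ⟨⟨j, MulEquiv.ofBijective (g j) ⟨Finite.injective_iff_surjective.mpr hsurj, hsurj⟩⟩, ?_⟩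
  have hfg : f = (g j).comp (Pi.evalMonoidHom (fun _ => S) j) := by
    refine MonoidHom.pi_ext fun l s => ?_
    by_cases h : l = j
    · subst h; simp [g]
    · simpa [g, Pi.mulSingle_eq_of_ne (Ne.symm h)] using htriv l h s
  exact fun x => DFunLike.congr_fun hfg x

theorem coord_mulAut_pi_unique [Nontrivial S] {p q : ι × MulAut S}
    (h : ∀ x : ι → S, p.2 (x p.1) = q.2 (x q.1)) : p = q := by
  classical
  have h1 : p.1 = q.1 := by
    by_contra hne
    obtain ⟨s, hs⟩ := exists_ne (1 : S)
    have := h (Pi.mulSingle p.1 s)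
    rw [Pi.mulSingle_eq_same, Pi.mulSingle_eq_of_ne (Ne.symm hne), map_one] at this
    exact hs ((map_eq_one_iff p.2 p.2.injective).mp this)
  refine Prod.ext h1 (MulEquiv.ext fun s => ?_)
  exact h fun _ => s

end AutPi

/-- The Kronecker power of a matrix representation `M` of `MulAut S`, extended to the automorphisms
of `ι → S` along a choice `c` of coordinates. -/
def kroneckerPowAut {S ι m : Type*} [Group S] [Fintype ι]
    (M : MulAut S → Matrix m m ℂ) (c : MulAut (ι → S) → ι → ι × MulAut S)
    (α : MulAut (ι → S)) : Matrix (ι → m) (ι → m) ℂ :=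
  Matrix.of fun f g => ∏ i, M (c α i).2 (f i) (g (c α i).1)

section KroneckerPow

variable {S ι m : Type*} [Group S] [Nontrivial S]
  {c : MulAut (ι → S) → ι → ι × MulAut S}
  (hc : ∀ α i x, α x i = (c α i).2 (x (c α i).1))

include hc

theorem coord_one (i : ι) : c 1 i = (i, 1) :=
  coord_mulAut_pi_unique fun x => (hc 1 i x).symm

theorem coord_conj (s : ι → S) (i : ι) : c (MulAut.conj s) i = (i, MulAut.conj (s i)) :=
  coord_mulAut_pi_unique fun x => (hc _ i x).symm

theorem coord_mul (α β : MulAut (ι → S)) (i : ι) :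
    c (α * β) i = ((c β (c α i).1).1, (c α i).2 * (c β (c α i).1).2) :=
  coord_mulAut_pi_unique fun x => by
    rw [← hc, MulAut.mul_apply, hc α, hc β, MulAut.mul_apply]

theorem coord_bijective [Finite ι] (α : MulAut (ι → S)) : Function.Bijective fun i => (c α i).1 := by
  refine Finite.injective_iff_bijective.mp (Function.HasLeftInverse.injective
    ⟨fun i => (c α⁻¹ i).1, fun i => ?_⟩)
  have := coord_mul hc α α⁻¹ i
  rw [mul_inv_cancel, coord_one hc] at this
  exact (congrArg Prod.fst this).symm

variable [Fintype ι] [Fintype m] [DecidableEq m] (M : MulAut S →* Matrix m m ℂ)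

theorem kroneckerPowAut_one : kroneckerPowAut M c 1 = 1 := by
  ext f g
  simp only [kroneckerPowAut, coord_one hc, map_one, Matrix.of_apply, Matrix.one_apply]
  rw [Finset.prod_ite_zero]
  simp [funext_iff]

theorem kroneckerPowAut_mul [DecidableEq ι] (α β : MulAut (ι → S)) :
    kroneckerPowAut M c (α * β) = kroneckerPowAut M c α * kroneckerPowAut M c β := by
  ext f g
  let τ : ι ≃ ι := Equiv.ofBijective _ (coord_bijective hc α)
  simp only [kroneckerPowAut, Matrix.mul_apply, Matrix.of_apply, coord_mul hc, map_mul]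
  rw [Finset.prod_univ_sum, Fintype.piFinset_univ]
  refine (Fintype.sum_equiv (τ.symm.arrowCongr (Equiv.refl m)) _ _ fun h => ?_).symm
  rw [← Equiv.prod_comp τ fun j => M (c β j).2 (h j) _, ← Finset.prod_mul_distrib]
  rfl

theorem trace_kroneckerPowAut_conj [DecidableEq ι] (s : ι → S) :
    (kroneckerPowAut M c (MulAut.conj s)).trace = ∏ i, (M (MulAut.conj (s i))).trace := by
  simp only [Matrix.trace, Matrix.diag, kroneckerPowAut, coord_conj hc, Matrix.of_apply]
  rw [Finset.prod_univ_sum, Fintype.piFinset_univ]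

end KroneckerPow

/-- A representation of a finite group whose restriction along some homomorphism from a finite group
is simple is itself simple. -/
theorem FDRep.simple_of_simple_res {G H : Type} [Group G] [Finite G] [Group H] [Finite H]
    (φ : H →* G) (U : FDRep ℂ G) (h : Simple ((Action.res (FGModuleCat ℂ) φ).obj U)) :
    Simple U := by
  rw [FDRep.simple_iff_end_is_rank_one]
  have h1 := (FDRep.simple_iff_end_is_rank_one ((Action.res (FGModuleCat ℂ) φ).obj U)).mp h
  have hle : Module.finrank ℂ (U ⟶ U) ≤ 1 := by
    rw [← h1]
    exact LinearMap.finrank_le_finrank_of_injective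
      (f := (Action.res (FGModuleCat ℂ) φ).mapLinearMap ℂ)
      (Action.res (FGModuleCat ℂ) φ).map_injective
  refine le_antisymm hle (Module.finrank_pos_iff_exists_ne_zero.mpr ⟨𝟙 U, fun h0 => ?_⟩)
  apply id_nonzero ((Action.res (FGModuleCat ℂ) φ).obj U)
  rw [← CategoryTheory.Functor.map_id, h0, Functor.map_zero]

theorem power_degree_of_extendable (K : Type) [Group K] [Finite K]
    (S : Type) [Group S] [Finite S] (hS : IsSimpleGroup S)
    (hnab : ¬ ∀ a b : S, a * b = b * a)
    (k : ℕ) (hk : 0 < k)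
    (N : Subgroup K) (hNnormal : N.Normal) (hNbot : N ≠ ⊥)
    (hmin : ∀ N' : Subgroup K, N'.Normal → N' ≤ N → N' = ⊥ ∨ N' = N)
    (e : N ≃* (Fin k → S))
    (V : FDRep ℂ S) (hV : Simple V)
    (hext : ∃ W : FDRep ℂ (MulAut S), Simple W ∧
      ∀ s : S, W.character (MulAut.conj s) = V.character s) :
    (Module.finrank ℂ V) ^ k ∈ charDegrees K := by
  classical
  obtain ⟨W, -, hW⟩ := hext
  have := Fintype.ofFinite S
  have hdim : Module.finrank ℂ W = Module.finrank ℂ V := by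
    have h := hW 1
    rw [map_one, FDRep.char_one, FDRep.char_one] at h
    exact_mod_cast h
  let b := Module.finBasis ℂ W
  let M : MulAut S →* Matrix (Fin (Module.finrank ℂ W)) (Fin (Module.finrank ℂ W)) ℂ :=
    (LinearMap.toMatrixAlgEquiv b).toMulEquiv.toMonoidHom.comp W.ρ
  have hM : ∀ s, (M (MulAut.conj s)).trace = V.character s := fun s => by
    rw [← hW]
    exact (LinearMap.trace_eq_matrix_trace ℂ b _).symm
  choose c hc using fun (α : MulAut (Fin k → S)) i => exists_coord_mulAut_pi hnab α i
  let R : MulAut (Fin k → S) →* Matrix (Fin k → Fin (Module.finrank ℂ W)) _ ℂ :=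
    { toFun := kroneckerPowAut M c
      map_one' := kroneckerPowAut_one hc M
      map_mul' := kroneckerPowAut_mul hc M }
  let act : K →* MulAut (Fin k → S) := (MulAut.congr e).toMonoidHom.comp MulAut.conjNormal
  have hact : ∀ s : Fin k → S, act (e.symm s : N) = MulAut.conj s := fun s => by
    ext1 x
    have : MulAut.conjNormal ((e.symm s : N) : K) (e.symm x) = e.symm s * e.symm x * (e.symm s)⁻¹ :=
      Subtype.ext (by simp [MulAut.conjNormal_apply])
    change e (MulAut.conjNormal ((e.symm s : N) : K) (e.symm x)) = _
    rw [this]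
    simp
  let ρ : Representation ℂ K ((Fin k → Fin (Module.finrank ℂ W)) → ℂ) :=
    (Matrix.toLinAlgEquiv' (R := ℂ)).toMulEquiv.toMonoidHom.comp (R.comp act)
  refine ⟨FDRep.of ρ, ?_, ?_⟩
  · let φ : (Fin k → S) →* K := N.subtype.comp e.symm.toMonoidHom
    apply FDRep.simple_of_simple_res φ
    have hchar : ∀ s, FDRep.character ((Action.res (FGModuleCat ℂ) φ).obj (FDRep.of ρ)) s
        = ∏ i, V.character (s i) := fun s => by
      have h1 : FDRep.character ((Action.res (FGModuleCat ℂ) φ).obj (FDRep.of ρ)) s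
          = LinearMap.trace ℂ _ (Matrix.toLin' (R (act (e.symm s : N)))) := rfl
      rw [h1, Matrix.trace_toLin'_eq, hact]
      simp_rw [← hM]
      exact trace_kroneckerPowAut_conj hc M s
    rw [FDRep.simple_iff_char_is_norm_one] at hV ⊢
    simp_rw [hchar, ← Finset.prod_mul_distrib, Pi.inv_apply]
    have := Finset.prod_univ_sum (fun _ : Fin k => (Finset.univ : Finset S))
      (fun _ s => V.character s * V.character s⁻¹)
    rw [Fintype.piFinset_univ] at this
    rw [← this, hV]
    simp
  · change Module.finrank ℂ ((Fin k → Fin (Module.finrank ℂ W)) → ℂ) = _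
    simp [hdim]
end

section
/- Let M ⊴ L ⊴ G be normal subgroups of a finite group G such that L/M is an abelian chief factor of G. Let θ ∈ Irr(M) be L-invariant and let λ be an irreducible constituent of the induced character θ^L. If λ(1) > θ(1) and λ is G-invariant, then λ(1)/θ(1) = √|L : M|. -/
open CategoryTheory

namespace Module.End

/-- If `T` has finite order and inverse `S`, then the traces of `T` and `S` are conjugate. -/
theorem trace_inv_eq_conj_of_pow_eq_one {V : Type*} [AddCommGroup V] [Module ℂ V]
    [FiniteDimensional ℂ V] {T S : End ℂ V} {n : ℕ} (hn : n ≠ 0) (hT : T ^ n = 1)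
    (hST : S * T = 1) :
    LinearMap.trace ℂ V S = starRingEnd ℂ (LinearMap.trace ℂ V T) := by
  have hss : T.IsSemisimple := by
    refine isSemisimple_of_squarefree_aeval_eq_zero
      (p := (Polynomial.X ^ n - 1 : Polynomial ℂ)) ?_ (by simp [hT])
    exact (Polynomial.X_pow_sub_one_separable_iff.mpr (by exact_mod_cast hn)).squarefree
  have hS : ∀ μ : ℂ, ∀ x ∈ T.eigenspace μ, S x = starRingEnd ℂ μ • x := by
    intro μ x hx
    rcases eq_or_ne x 0 with rfl | hx0
    · simp
    have hpow : μ ^ n = 1 := by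
      have h := HasEigenvector.pow_apply (f := T) (μ := μ) (v := x) ⟨hx, hx0⟩ n
      rw [hT, End.one_apply] at h
      by_contra hne
      have : (μ ^ n - 1) • x = 0 := by rw [sub_smul, ← h, one_smul, sub_self]
      rcases smul_eq_zero.mp this with h' | h'
      · exact hne (sub_eq_zero.mp h')
      · exact hx0 h'
    have hμ : starRingEnd ℂ μ * μ = 1 := by
      rw [Complex.conj_mul', Complex.norm_eq_one_of_pow_eq_one hpow hn]; simp
    have hx' : T x = μ • x := mem_eigenspace_iff.mp hx
    calc S x = S ((starRingEnd ℂ μ * μ) • x) := by rw [hμ, one_smul]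
      _ = starRingEnd ℂ μ • (S * T) x := by rw [mul_smul, map_smul, ← hx']; rfl
      _ = _ := by rw [hST]; rfl
  have hint : DirectSum.IsInternal T.eigenspace := by
    classical
    exact DirectSum.isInternal_submodule_of_iSupIndep_of_iSup_eq_top T.eigenspaces_iSupIndep
      hss.iSup_eigenspace_eq_top
  have hfin : {μ | T.eigenspace μ ≠ ⊥}.Finite :=
    WellFoundedGT.finite_ne_bot_of_iSupIndep hint.submodule_iSupIndep
  have hTm : ∀ μ, Set.MapsTo T (T.eigenspace μ) (T.eigenspace μ) := fun μ x hx => by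
    rw [SetLike.mem_coe] at hx ⊢
    rw [mem_eigenspace_iff.mp hx]
    exact Submodule.smul_mem _ _ hx
  have hSm : ∀ μ, Set.MapsTo S (T.eigenspace μ) (T.eigenspace μ) := fun μ x hx => by
    rw [SetLike.mem_coe] at hx ⊢
    rw [hS μ x hx]
    exact Submodule.smul_mem _ _ hx
  classical
  rw [LinearMap.trace_eq_sum_trace_restrict' hint hfin hTm,
    LinearMap.trace_eq_sum_trace_restrict' hint hfin hSm, map_sum]
  refine Finset.sum_congr rfl fun μ _ => ?_
  have h1 : T.restrict (hTm μ) = μ • LinearMap.id := by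
    exact LinearMap.ext fun x => Subtype.ext (mem_eigenspace_iff.mp x.2)
  have h2 : S.restrict (hSm μ) = starRingEnd ℂ μ • LinearMap.id := by
    exact LinearMap.ext fun x => Subtype.ext (hS μ x x.2)
  rw [h1, h2]
  simp

end Module.End

namespace FDRep

variable {H : Type} [Group H]

theorem char_inv_eq_conj [Finite H] (V : FDRep ℂ H) (g : H) :
    V.character g⁻¹ = starRingEnd ℂ (V.character g) := by
  refine Module.End.trace_inv_eq_conj_of_pow_eq_one (n := Nat.card H) Nat.card_pos.ne' ?_ ?_
  · rw [← map_pow, pow_card_eq_one', map_one]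
  · rw [← map_mul, inv_mul_cancel, map_one]

/-- Schur's lemma, phrased with linear endomorphisms. -/
theorem exists_eq_smul_one_of_commute (V : FDRep ℂ H) [Simple V] (T : V →ₗ[ℂ] V)
    (hT : ∀ g, V.ρ g * T = T * V.ρ g) : ∃ c : ℂ, T = c • 1 := by
  let F : V ⟶ V := ⟨InducedCategory.homMk (ModuleCat.ofHom T), fun g => by
    ext x
    exact (LinearMap.congr_fun (hT g) x).symm⟩
  obtain ⟨c, hc⟩ := endomorphism_simple_eq_smul_id ℂ F
  refine ⟨c, ?_⟩
  have h := congrArg (fun f : V ⟶ V => f.hom.hom.hom) hc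
  exact h.symm

/-- Convolution with a class function multiplies an irreducible character by a scalar. -/
theorem sum_class_function_mul_char [Fintype H] (V : FDRep ℂ H) [Simple V] (f : H → ℂ)
    (hf : ∀ g h, f (h * g * h⁻¹) = f g) (k : H) :
    V.character 1 * ∑ h, f h * V.character (h⁻¹ * k) =
      (∑ h, f h * V.character h⁻¹) * V.character k := by
  obtain ⟨c, hc⟩ := V.exists_eq_smul_one_of_commute (∑ h, f h • V.ρ h⁻¹) fun g => by
    rw [Finset.mul_sum, Finset.sum_mul]
    refine Fintype.sum_equiv (MulAut.conj g).toEquiv _ _ fun h => ?_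
    simp only [MulEquiv.toEquiv_eq_coe, MulEquiv.coe_toEquiv, MulAut.conj_apply, hf,
      mul_smul_comm, smul_mul_assoc, ← map_mul]
    congr 2
    group
  have key : ∀ k, ∑ h, f h * V.character (h⁻¹ * k) = c * V.character k := fun k => by
    have := congrArg (fun T => LinearMap.trace ℂ V (T * V.ρ k)) hc
    simpa [Finset.sum_mul, ← map_mul, character] using this
  have h1 := key 1
  simp only [mul_one] at h1
  rw [key, h1]
  ring

theorem char_one_ne_zero [Finite H] (V : FDRep ℂ H) [Simple V] : V.character 1 ≠ 0 := by
  rw [char_one, Nat.cast_ne_zero]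
  intro h
  have : Subsingleton V := Module.finrank_zero_iff.mp h
  apply id_nonzero V
  ext x
  exact Subsingleton.elim _ _

theorem sum_char_mul_char_inv [Fintype H] (V : FDRep ℂ H) [Simple V] :
    ∑ h, V.character h * V.character h⁻¹ = Nat.card H := by
  have hne : (Nat.card H : ℂ) ≠ 0 := Nat.cast_ne_zero.mpr Nat.card_pos.ne'
  let := invertibleOfNonzero hne
  have h := char_orthonormal V V
  rw [if_pos ⟨Iso.refl V⟩] at h
  field_simp at h
  exact h

/-- If an irreducible character is not orthogonal to its twist by a linear character,
then it equals that twist. -/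
theorem mul_char_eq_char_of_sum_ne_zero [Fintype H] (V : FDRep ℂ H) [Simple V] (ν : H →* ℂˣ)
    (hν : ∑ h, (ν h : ℂ) * V.character h * V.character h⁻¹ ≠ 0) (k : H) :
    (ν k : ℂ) * V.character k = V.character k := by
  have h1 := V.sum_class_function_mul_char (fun h => (ν h : ℂ) * V.character h)
    (fun g h => by simp) k
  have h2 := V.sum_class_function_mul_char (fun h => ((ν h)⁻¹ : ℂˣ) * V.character h)
    (fun g h => by simp) k
  have e1 : ∑ h, ((ν h)⁻¹ : ℂˣ) * V.character h * V.character h⁻¹ =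
      ∑ h, (ν h : ℂ) * V.character h * V.character h⁻¹ :=
    Fintype.sum_equiv (Equiv.inv H) _ _ fun h => by simp; ring
  have e2 : (ν k : ℂ) * ∑ h, ((ν h)⁻¹ : ℂˣ) * V.character h * V.character (h⁻¹ * k) =
      ∑ h, (ν h : ℂ) * V.character h * V.character (h⁻¹ * k) := by
    rw [Finset.mul_sum]
    refine Fintype.sum_equiv ((Equiv.inv H).trans (Equiv.mulLeft k)) _ _ fun h => ?_
    have : V.character (k * h⁻¹) = V.character (h⁻¹ * k) := char_mul_comm V _ _
    simp [this]
    ring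
  rw [e1] at h2
  refine mul_left_cancel₀ hν ?_
  rw [← h1, ← e2]
  linear_combination - (ν k : ℂ) * h2

/-- **Clifford's theorem** for an invariant character of a normal subgroup: the restriction of an
irreducible character lying over it is proportional to it. -/
theorem char_proportional_of_invariant {N : Type} [Group N] [Fintype N] [Fintype H]
    (i : N →* H) (hi : Function.Injective i) (hnormal : i.range.Normal)
    (W : FDRep ℂ N) [Simple W] (V : FDRep ℂ H) [Simple V]
    (hinv : ∀ h n n', i n' = h * i n * h⁻¹ → W.character n' = W.character n)
    (hne : ∑ n, V.character (i n) * W.character n⁻¹ ≠ 0) (k : N) :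
    W.character 1 * V.character (i k) = V.character 1 * W.character k := by
  have hext : ∀ n, Function.extend i W.character 0 (i n) = W.character n := hi.extend_apply _ _
  have hsum : ∀ F : H → ℂ, ∑ h, Function.extend i W.character 0 h * F h =
      ∑ n, W.character n * F (i n) := fun F => by
    refine (Fintype.sum_of_injective i hi _ _ (fun h hh => ?_) fun n => by rw [hext]).symm
    rw [Function.extend_apply' _ _ _ (by simpa using hh)]
    simp
  have h1 := V.sum_class_function_mul_char (Function.extend i W.character 0) (fun g h => by
    by_cases hg : g ∈ i.range
    · obtain ⟨n', hn'⟩ := hnormal.conj_mem g hg h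
      obtain ⟨n, rfl⟩ := hg
      rw [← hn', hext, hext, hinv h n n' hn']
    · rw [Function.extend_apply' _ _ _ hg, Function.extend_apply' _ _ _ fun hg' => hg ?_]
      · rfl
      · have := hnormal.conj_mem _ hg' h⁻¹
        simpa [mul_assoc] using this) (i k)
  rw [hsum, hsum] at h1
  have h2 := W.sum_class_function_mul_char (fun n => V.character (i n)) (fun g h => by simp) k
  have e1 : ∑ n, W.character n * V.character (i n)⁻¹ =
      ∑ n, V.character (i n) * W.character n⁻¹ :=
    Fintype.sum_equiv (Equiv.inv N) _ _ fun n => by simp; ring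
  have e2 : ∑ n, W.character n * V.character ((i n)⁻¹ * i k) =
      ∑ n, V.character (i n) * W.character (n⁻¹ * k) := by
    refine Fintype.sum_equiv ((Equiv.inv N).trans (Equiv.mulLeft k)) _ _ fun n => ?_
    have : V.character (i k * (i n)⁻¹) = V.character ((i n)⁻¹ * i k) := char_mul_comm V _ _
    simp [this]
    ring
  rw [e1, e2] at h1
  refine mul_left_cancel₀ hne ?_
  linear_combination V.character 1 * h2 - W.character 1 * h1

/-- If no nontrivial linear character of `H ⧸ K` stabilizes an irreducible character of `H`, then
the restriction of that character to `K` has norm one. -/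
theorem sum_char_subgroup_of_stabilizer_trivial [Fintype H] (V : FDRep ℂ H) [Simple V]
    (K : Subgroup H) [K.Normal] [Fintype K] [hK : IsMulCommutative (H ⧸ K)]
    (hstab : ∀ ν : H →* ℂˣ, (∀ k ∈ K, ν k = 1) →
      (∀ h, (ν h : ℂ) * V.character h = V.character h) → ν = 1) :
    ∑ k : K, V.character k * V.character (k : H)⁻¹ = Nat.card K := by
  classical
  let : CommGroup (H ⧸ K) :=
    { (inferInstance : Group (H ⧸ K)) with
      mul_comm := hK.is_comm.comm }
  have : Fintype ((H ⧸ K) →* ℂˣ) := Fintype.ofFinite _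
  have hzero : ∀ q : H ⧸ K, q ≠ 1 → ∑ a : (H ⧸ K) →* ℂˣ, (a q : ℂ) = 0 := fun q hq => by
    obtain ⟨b, hb⟩ := CommGroup.exists_apply_ne_one_of_hasEnoughRootsOfUnity (H ⧸ K) ℂ hq
    have h : (b q : ℂ) * ∑ a : (H ⧸ K) →* ℂˣ, (a q : ℂ) = ∑ a : (H ⧸ K) →* ℂˣ, (a q : ℂ) := by
      rw [Finset.mul_sum]
      exact Fintype.sum_equiv (Equiv.mulLeft b) _ _ fun a => by simp
    by_contra hne
    exact hb (Units.ext (mul_right_cancel₀ hne (by simpa using h)))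
  have hone : ∀ a : (H ⧸ K) →* ℂˣ, a ≠ 1 →
      ∑ h : H, (a h : ℂ) * V.character h * V.character h⁻¹ = 0 := fun a ha => by
    by_contra hne
    have h := hstab (a.comp (QuotientGroup.mk' K)) (fun k hk => by
      simp [(QuotientGroup.eq_one_iff k).mpr hk]) (V.mul_char_eq_char_of_sum_ne_zero _ hne)
    refine ha (MonoidHom.ext fun q => ?_)
    obtain ⟨x, rfl⟩ := QuotientGroup.mk_surjective q
    exact DFunLike.congr_fun h x
  have hdouble : ∑ a : (H ⧸ K) →* ℂˣ, ∑ h : H, (a h : ℂ) * V.character h * V.character h⁻¹ =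
      Nat.card H := by
    rw [Fintype.sum_eq_single 1 fun a ha => hone a ha, ← V.sum_char_mul_char_inv]
    simp
  have hcard : (Fintype.card ((H ⧸ K) →* ℂˣ) : ℂ) = Nat.card (H ⧸ K) := by
    rw [← CommGroup.card_monoidHom_of_hasEnoughRootsOfUnity (H ⧸ K) ℂ, Nat.card_eq_fintype_card]
  rw [Finset.sum_comm, ← Fintype.sum_of_injective ((↑) : K → H) Subtype.val_injective
    (fun k => (Nat.card (H ⧸ K) : ℂ) * (V.character k * V.character (k : H)⁻¹)) _ (fun h hh => ?_)
    (fun k => ?_), ← Finset.mul_sum, K.card_eq_card_quotient_mul_card_subgroup,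
    Nat.cast_mul] at hdouble
  · exact mul_left_cancel₀ (Nat.cast_ne_zero.mpr Nat.card_pos.ne') hdouble
  · simp_rw [mul_assoc]
    rw [← Finset.sum_mul, hzero, zero_mul]
    rw [Ne, QuotientGroup.eq_one_iff]
    simpa using hh
  · simp [(QuotientGroup.eq_one_iff (k : H)).mpr k.2, hcard]

end FDRep

/-- Lemma 2.9: Let `M ⊴ L ⊴ G` with `L/M` an abelian chief factor of `G`.  Let `θ ∈ Irr(M)` be
`L`-invariant and let `λ` be an irreducible constituent of `θ^L` (equivalently, by Frobenius
reciprocity, `θ` is a constituent of `λ_M`, i.e. `⟨λ_M, θ⟩ ≠ 0`).  If `λ(1) > θ(1)` and `λ` is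
`G`-invariant, then `λ(1)/θ(1) = √|L : M|`, i.e. `λ(1)² = |L : M| ⬝ θ(1)²`. -/
theorem degree_ratio_sqrt_of_chief_factor (G : Type) [Group G] [Finite G]
    (M L : Subgroup G) (hML : M ≤ L) (hM : M.Normal) (hL : L.Normal)
    -- `L/M` is an abelian chief factor of `G`:
    (habelian : ∀ x ∈ L.map (QuotientGroup.mk' M), ∀ y ∈ L.map (QuotientGroup.mk' M),
      x * y = y * x)
    (hbot : L.map (QuotientGroup.mk' M) ≠ ⊥)
    (hnormal : (L.map (QuotientGroup.mk' M)).Normal)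
    (hchief : ∀ N' : Subgroup (G ⧸ M), N'.Normal → N' ≤ L.map (QuotientGroup.mk' M) →
      N' = ⊥ ∨ N' = L.map (QuotientGroup.mk' M))
    (θ : FDRep ℂ M) (hθ : Simple θ)
    -- `θ` is `L`-invariant:
    (hθinv : ∀ l ∈ L, ∀ (m : G) (hm : m ∈ M) (hc : l * m * l⁻¹ ∈ M),
      θ.character ⟨l * m * l⁻¹, hc⟩ = θ.character ⟨m, hm⟩)
    (lam : FDRep ℂ L) (hlam : Simple lam)
    -- `λ` is a constituent of `θ^L`, i.e. `⟨λ_M, θ⟩ ≠ 0`: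
    (hconst : (∑ᶠ m : M, lam.character (Subgroup.inclusion hML m) *
      (starRingEnd ℂ) (θ.character m)) ≠ 0)
    (hdeg : Module.finrank ℂ θ < Module.finrank ℂ lam)
    -- `λ` is `G`-invariant:
    (hlaminv : ∀ (g : G), ∀ (l : G) (hl : l ∈ L) (hc : g * l * g⁻¹ ∈ L),
      lam.character ⟨g * l * g⁻¹, hc⟩ = lam.character ⟨l, hl⟩) :
    (Module.finrank ℂ lam) ^ 2 = (M.subgroupOf L).index * (Module.finrank ℂ θ) ^ 2 := by
  classical
  have := Fintype.ofFinite M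
  have := Fintype.ofFinite L
  have hMidx : ((M.subgroupOf L).index : ℂ) * Nat.card M = Nat.card L := by
    rw [← (M.subgroupOf L).index_mul_card,
      Nat.card_congr (Subgroup.subgroupOfEquivOfLe hML).toEquiv, Nat.cast_mul]
  have hchief' : ∀ N : Subgroup G, N.Normal → M ≤ N → N ≤ L → N = M ∨ N = L := by
    intro N hN hMN hNL
    have hcomap : ∀ K : Subgroup G, M ≤ K →
        (K.map (QuotientGroup.mk' M)).comap (QuotientGroup.mk' M) = K := fun K hK => by
      rw [Subgroup.comap_map_eq, QuotientGroup.ker_mk', sup_eq_left.mpr hK]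
    have hNmap := hN.map _ (QuotientGroup.mk'_surjective M)
    refine (hchief _ hNmap (Subgroup.map_mono hNL)).imp (fun h => ?_) fun h => ?_
    · rw [← hcomap N hMN, h, MonoidHom.comap_bot, QuotientGroup.ker_mk']
    · rw [← hcomap N hMN, h, hcomap L hML]
  have hcomm : IsMulCommutative (L ⧸ M.subgroupOf L) := ⟨⟨fun a b => by
    obtain ⟨x, rfl⟩ := QuotientGroup.mk_surjective a
    obtain ⟨y, rfl⟩ := QuotientGroup.mk_surjective b
    have h := habelian _ (Subgroup.mem_map_of_mem _ x.2) _ (Subgroup.mem_map_of_mem _ y.2)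
    rw [← map_mul, ← map_mul, QuotientGroup.mk'_apply, QuotientGroup.mk'_apply,
      QuotientGroup.eq] at h
    rw [← QuotientGroup.mk_mul, ← QuotientGroup.mk_mul, QuotientGroup.eq]
    exact Subgroup.mem_subgroupOf.mpr h⟩⟩
  have hprop := FDRep.char_proportional_of_invariant (Subgroup.inclusion hML)
    (Subgroup.inclusion_injective hML) (by
      rw [Subgroup.inclusion_range]; infer_instance) θ lam
    (fun l m m' h => by
      have h' : (m' : G) = l * m * (l : G)⁻¹ := congrArg Subtype.val h
      have := hθinv l l.2 m m.2 (h' ▸ m'.2)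
      rw [← this]
      congr 1
      exact Subtype.ext h')
    (by
      rw [finsum_eq_sum_of_fintype] at hconst
      simpa only [FDRep.char_inv_eq_conj] using hconst)
  set t := θ.character 1 with ht
  set d := lam.character 1 with hd
  have ht' : t = (Module.finrank ℂ θ : ℂ) := FDRep.char_one θ
  have hd' : d = (Module.finrank ℂ lam : ℂ) := FDRep.char_one lam
  -- The norm of the restriction of `λ` to `M`.
  have hnorm : t ^ 2 * ∑ m : M, lam.character (Subgroup.inclusion hML m) *
      lam.character (Subgroup.inclusion hML m)⁻¹ = d ^ 2 * Nat.card M := by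
    rw [← θ.sum_char_mul_char_inv, Finset.mul_sum, Finset.mul_sum]
    refine Finset.sum_congr rfl fun m _ => ?_
    have h1 := hprop m
    have h2 := hprop m⁻¹
    rw [map_inv] at h2
    linear_combination (t * lam.character (Subgroup.inclusion hML m)⁻¹) * h1 +
      d * θ.character m * h2
  -- The intersection of the kernels of the linear characters of `L / M` that stabilize `λ`.
  let S : Set (L →* ℂˣ) := {ν | (∀ x ∈ M.subgroupOf L, ν x = 1) ∧
    ∀ x, (ν x : ℂ) * lam.character x = lam.character x}
  have hconj : ∀ (g : G) (x : L),
      lam.character (MulAut.conjNormal g x) = lam.character x := fun g x => by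
    rw [← hlaminv g x x.2 (hL.conj_mem x x.2 g)]
    exact congrArg _ (Subtype.ext (MulAut.conjNormal_apply g x))
  have hSconj : ∀ ν ∈ S, ∀ g : G, ν.comp (MulAut.conjNormal g).toMonoidHom ∈ S :=
    fun ν hν g => ⟨fun x hx => hν.1 _ (by
      rw [Subgroup.mem_subgroupOf] at hx ⊢
      simpa using hM.conj_mem _ hx g), fun x => by
      simpa [hconj] using hν.2 (MulAut.conjNormal g x)⟩
  let K : Subgroup L := ⨅ ν ∈ S, ν.ker
  have hKmem : ∀ x, x ∈ K ↔ ∀ ν ∈ S, ν x = 1 := fun x => by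
    simp [K, Subgroup.mem_iInf, MonoidHom.mem_ker]
  have hKnormal : (K.map L.subtype).Normal := ⟨by
    rintro _ ⟨x, hx, rfl⟩ g
    refine ⟨MulAut.conjNormal g x, (hKmem _).mpr fun ν hν => ?_, by simp⟩
    exact (hKmem x).mp hx _ (hSconj ν hν g)⟩
  rcases hchief' _ hKnormal
    (fun m hm => ⟨⟨m, hML hm⟩, (hKmem _).mpr fun ν hν => hν.1 _ hm, rfl⟩)
    (Subgroup.map_subtype_le K) with hK | hK
  · have hvanish : ∀ x : L, (x : G) ∉ M → lam.character x = 0 := fun x hx => by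
      have hxK : x ∉ K := fun h => hx (hK ▸ Subgroup.mem_map_of_mem L.subtype h)
      rw [hKmem] at hxK
      push Not at hxK
      obtain ⟨ν, hν, hne⟩ := hxK
      by_contra h0
      exact hne (Units.ext (mul_right_cancel₀ h0 (by simpa using hν.2 x)))
    have hsum := lam.sum_char_mul_char_inv
    rw [← Fintype.sum_of_injective (Subgroup.inclusion hML) (Subgroup.inclusion_injective hML)
      _ _ (fun x hx => by
        rw [hvanish x fun hxM => hx ⟨⟨x, hxM⟩, rfl⟩, zero_mul]) fun m => rfl] at hsum
    rw [hsum, ← hMidx] at hnorm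
    have hcard : (Nat.card M : ℂ) ≠ 0 := Nat.cast_ne_zero.mpr Nat.card_pos.ne'
    have hfinal : d ^ 2 = (M.subgroupOf L).index * t ^ 2 :=
      mul_right_cancel₀ hcard (by linear_combination -hnorm)
    rw [ht', hd'] at hfinal
    exact_mod_cast hfinal
  · have hSone : ∀ ν : L →* ℂˣ, (∀ x ∈ M.subgroupOf L, ν x = 1) →
        (∀ x, (ν x : ℂ) * lam.character x = lam.character x) → ν = 1 := fun ν h1 h2 => by
      refine MonoidHom.ext fun x => ?_
      obtain ⟨y, hy, hyx⟩ : (x : G) ∈ K.map L.subtype := by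
        rw [hK]
        exact x.2
      exact (hKmem x).mp (Subtype.ext hyx ▸ hy) ν ⟨h1, h2⟩
    have hsum := lam.sum_char_subgroup_of_stabilizer_trivial (M.subgroupOf L) hSone
    rw [Nat.card_congr (Subgroup.subgroupOfEquivOfLe hML).toEquiv,
      Fintype.sum_equiv (Subgroup.subgroupOfEquivOfLe hML).toEquiv
        (fun x : M.subgroupOf L => lam.character x * lam.character (x : L)⁻¹)
        (fun m : M => lam.character (Subgroup.inclusion hML m) *
          lam.character (Subgroup.inclusion hML m)⁻¹) fun m => rfl] at hsum
    rw [hsum] at hnorm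
    have hcard : (Nat.card M : ℂ) ≠ 0 := Nat.cast_ne_zero.mpr Nat.card_pos.ne'
    have hfinal := mul_right_cancel₀ hcard hnorm
    rw [ht', hd'] at hfinal
    have hfinal' : Module.finrank ℂ θ ^ 2 = Module.finrank ℂ lam ^ 2 := by exact_mod_cast hfinal
    exact absurd (Nat.pow_left_injective two_ne_zero hfinal') hdeg.ne
end
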